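/- Assume Hypothesis (H0), let β ≥ 0, let C_HP > 0 be a constant such that ∫_0^1 v²/σ dx ≤ C_HP ∫_0^1 (v')² dx for all v ∈ H¹_{1/σ,0}(0,1), and let λ ∈ ℝ. Then the variational problem ∫_0^1 η z' φ' dx + β z(1) φ(1) = λ φ(1) for all φ ∈ H¹_{1/σ,0}(0,1) admits a unique solution z ∈ H¹_{1/σ,0}(0,1). This solution satisfies ∫_0^1 η (z')² dx + β z(1)² ≤ λ²/min_{[0,1]} η and ∫_0^1 z²/σ dx ≤ ((max_{[0,1]} η + C_HP)/(min_{[0,1]} η)²) λ². Moreover z ∈ H²_{1/σ,0}(0,1), (η z')' = 0 a.e. in (0,1), and η(1) z'(1) + β z(1) = λ. -/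

import Mathlib

open MeasureTheory Set Filter Topology

/-- The Feller weight `η(x) = exp (∫_{1/2}^x b/a)`. -/
noncomputable def etaW (a b : ℝ → ℝ) (x : ℝ) : ℝ :=
  Real.exp (∫ s in (1/2 : ℝ)..x, b s / a s)

/-- The weight `σ = a / η`. -/
noncomputable def sigW (a b : ℝ → ℝ) (x : ℝ) : ℝ :=
  a x / etaW a b x

/-- `u ∈ H¹(0,1)` with (a.e.) derivative `u'`. -/
structure MemH1 (u u' : ℝ → ℝ) : Prop where
  cont : ContinuousOn u (Set.Icc 0 1)
  hasDeriv : ∀ᵐ x ∂(volume.restrict (Set.Ioo (0:ℝ) 1)), HasDerivAt u (u' x) x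
  deriv_sq_int : IntegrableOn (fun x => (u' x) ^ 2) (Set.Ioo (0:ℝ) 1)
  ftc : ∀ x ∈ Set.Icc (0:ℝ) 1, u x = u 0 + ∫ t in Set.Ioo (0:ℝ) x, u' t

/-- `u ∈ L²_{1/σ}(0,1)`. -/
def MemL2sig (a b u : ℝ → ℝ) : Prop :=
  IntegrableOn (fun x => (u x) ^ 2) (Set.Ioo (0:ℝ) 1) ∧
  IntegrableOn (fun x => (u x) ^ 2 / sigW a b x) (Set.Ioo (0:ℝ) 1)

/-- `u ∈ H¹_{1/σ}(0,1)`. -/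
structure MemH1sig (a b u u' : ℝ → ℝ) extends MemH1 u u' : Prop where
  l2sig : MemL2sig a b u

/-- `u ∈ H¹_{1/σ,0}(0,1)`. -/
structure MemH1sig0 (a b u u' : ℝ → ℝ) extends MemH1sig a b u u' : Prop where
  zero : u 0 = 0

/-- `u ∈ H²_{1/σ}(0,1)`: `η u'` is locally absolutely continuous on `(0,1]`
with derivative `w`, and `Au = σ (η u')' = σ w ∈ L²_{1/σ}`. -/
structure MemH2sig (a b u u' w : ℝ → ℝ) extends MemH1sig a b u u' : Prop where
  w_locint : ∀ c ∈ Set.Ioc (0:ℝ) 1, IntegrableOn w (Set.Icc c 1)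
  locAC : ∀ c ∈ Set.Ioc (0:ℝ) 1, ∀ x ∈ Set.Icc c 1,
    etaW a b x * u' x = etaW a b c * u' c + ∫ t in Set.Ioo c x, w t
  Au_l2sig : MemL2sig a b (fun x => sigW a b x * w x)

/-- `u ∈ H²_{1/σ,0}(0,1)`. -/
structure MemH2sig0 (a b u u' w : ℝ → ℝ) extends MemH2sig a b u u' w : Prop where
  zero : u 0 = 0

/-- Hypothesis (H0): there is `K > 0` such that `x ↦ x^K / a x` is nondecreasing
in a right neighborhood of `0`. -/
def HypH0K (a : ℝ → ℝ) (K : ℝ) : Prop :=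
  0 < K ∧ ∃ ε > (0:ℝ), ∀ x y : ℝ, 0 < x → x ≤ y → y ≤ ε →
    x ^ K / a x ≤ y ^ K / a y

def HypH0 (a : ℝ → ℝ) : Prop := ∃ K : ℝ, HypH0K a K

theorem memH1_primitive_indicator {g : ℝ → ℝ} (hg : ContinuousOn g (Icc 0 1)) (p q : ℝ) :
    MemH1 (fun x => ∫ t in (0 : ℝ)..x, (Icc p q).indicator g t) ((Icc p q).indicator g) := by
  have hgi : IntegrableOn g (Icc 0 1) := hg.integrableOn_compact isCompact_Icc
  have hi : IntegrableOn ((Icc p q).indicator g) (Icc 0 1) :=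
    hgi.indicator measurableSet_Icc
  have hii : ∀ x ∈ Icc (0 : ℝ) 1,
      IntervalIntegrable ((Icc p q).indicator g) volume 0 x := fun x hx => by
    rw [intervalIntegrable_iff_integrableOn_Icc_of_le hx.1]
    exact hi.mono_set (Icc_subset_Icc_right hx.2)
  refine ⟨?_, ?_, ?_, ?_⟩
  · have := intervalIntegral.continuousOn_primitive_interval' (hii 1 (by simp)) left_mem_uIcc
    rwa [uIcc_of_le zero_le_one] at this
  · have hp : ∀ᵐ x ∂(volume.restrict (Ioo (0 : ℝ) 1)), x ≠ p :=
      ae_restrict_of_ae (Measure.ae_ne volume p)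
    have hq : ∀ᵐ x ∂(volume.restrict (Ioo (0 : ℝ) 1)), x ≠ q :=
      ae_restrict_of_ae (Measure.ae_ne volume q)
    filter_upwards [hp, hq, ae_restrict_mem measurableSet_Ioo] with x hxp hxq hx
    refine intervalIntegral.integral_hasDerivAt_right (hii x (Ioo_subset_Icc_self hx))
      ⟨Icc 0 1, Icc_mem_nhds hx.1 hx.2, hi.aestronglyMeasurable⟩ ?_
    rw [continuousAt_congr (g := if x ∈ Icc p q then g else 0)]
    · split_ifs
      · exact hg.continuousAt (Icc_mem_nhds hx.1 hx.2)
      · exact continuousAt_const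
    · split_ifs with h
      · filter_upwards [Icc_mem_nhds (lt_of_le_of_ne h.1 hxp.symm) (lt_of_le_of_ne h.2 hxq)]
          with y hy using indicator_of_mem hy g
      · filter_upwards [isClosed_Icc.isOpen_compl.mem_nhds h] with y hy
          using indicator_of_notMem hy g
  · have h2 : IntegrableOn (fun x => g x ^ 2) (Icc 0 1) :=
      (hg.pow 2).integrableOn_compact isCompact_Icc
    have h3 : IntegrableOn ((Icc p q).indicator fun x => g x ^ 2) (Icc 0 1) :=
      h2.indicator measurableSet_Icc
    refine (h3.mono_set Ioo_subset_Icc_self).congr_fun (fun x _ => ?_) measurableSet_Ioo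
    by_cases h : x ∈ Icc p q <;> simp [h]
  · intro x hx
    simp only [intervalIntegral.integral_same, zero_add]
    rw [intervalIntegral.integral_of_le hx.1, integral_Ioc_eq_integral_Ioo]

theorem abs_primitive_indicator_le {g : ℝ → ℝ} {M : ℝ} (hM : ∀ x ∈ Icc (0 : ℝ) 1, |g x| ≤ M)
    (p q : ℝ) {x : ℝ} (hx : x ∈ Icc (0 : ℝ) 1) :
    |∫ t in (0 : ℝ)..x, (Icc p q).indicator g t| ≤ M * x := by
  have hM0 : 0 ≤ M := (abs_nonneg _).trans (hM 0 (by simp))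
  have := intervalIntegral.norm_integral_le_of_norm_le_const (a := 0) (b := x) (C := M)
    (f := (Icc p q).indicator g) (fun t ht => by
      rw [uIoc_of_le hx.1] at ht
      by_cases h : t ∈ Icc p q
      · simpa [h] using hM t ⟨ht.1.le, ht.2.trans hx.2⟩
      · simpa [h] using hM0)
  simpa [abs_of_nonneg hx.1] using this

theorem primitive_indicator_eq (g : ℝ → ℝ) {q r : ℝ} (hq : q ∈ Icc (0 : ℝ) r) :
    ∫ t in (0 : ℝ)..r, (Icc 0 q).indicator g t = ∫ t in Ioo 0 q, g t := by
  rw [intervalIntegral.integral_of_le (hq.1.trans hq.2), setIntegral_indicator measurableSet_Icc,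
    ← integral_Ioc_eq_integral_Ioo]
  congr 2
  ext t
  simp only [mem_inter_iff, mem_Ioc, mem_Icc]
  exact ⟨fun h => ⟨h.1.1, h.2.2⟩, fun h => ⟨⟨h.1, h.2.trans hq.2⟩, h.1.le, h.2⟩⟩

section Weight

variable {a b : ℝ → ℝ}

theorem etaW_pos (a b : ℝ → ℝ) (x : ℝ) : 0 < etaW a b x := Real.exp_pos _

theorem continuousOn_etaW (hba : IntegrableOn (fun x => b x / a x) (Ioo (0 : ℝ) 1)) :
    ContinuousOn (etaW a b) (Icc 0 1) := by
  have h : IntervalIntegrable (fun x => b x / a x) volume 0 1 := by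
    rwa [intervalIntegrable_iff_integrableOn_Ioo_of_le zero_le_one]
  have := intervalIntegral.continuousOn_primitive_interval' (a := 1 / 2) h
    (by rw [uIcc_of_le zero_le_one]; constructor <;> norm_num)
  rw [uIcc_of_le zero_le_one] at this
  exact Real.continuous_exp.comp_continuousOn this

theorem sigW_pos (hapos : ∀ x ∈ Ioc (0 : ℝ) 1, 0 < a x) {x : ℝ} (hx : x ∈ Ioc (0 : ℝ) 1) :
    0 < sigW a b x := div_pos (hapos x hx) (etaW_pos a b x)

theorem continuousOn_sq_div_sigW (ha : ContinuousOn a (Icc 0 1))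
    (hapos : ∀ x ∈ Ioc (0 : ℝ) 1, 0 < a x)
    (hba : IntegrableOn (fun x => b x / a x) (Ioo (0 : ℝ) 1))
    {u : ℝ → ℝ} (hu : ContinuousOn u (Icc 0 1)) :
    ContinuousOn (fun x => u x ^ 2 / sigW a b x) (Ioc 0 1) := by
  have hs : ContinuousOn (sigW a b) (Icc 0 1) :=
    ha.div (continuousOn_etaW hba) fun x _ => (etaW_pos a b x).ne'
  exact ((hu.pow 2).mono Ioc_subset_Icc_self).div (hs.mono Ioc_subset_Icc_self)
    fun x hx => (sigW_pos hapos hx).ne'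

theorem memH1sig0_primitive_indicator_of_pos (ha : ContinuousOn a (Icc 0 1))
    (hapos : ∀ x ∈ Ioc (0 : ℝ) 1, 0 < a x)
    (hba : IntegrableOn (fun x => b x / a x) (Ioo (0 : ℝ) 1))
    {g : ℝ → ℝ} (hg : ContinuousOn g (Icc 0 1)) {p : ℝ} (hp : 0 < p) (q : ℝ) :
    MemH1sig0 a b (fun x => ∫ t in (0 : ℝ)..x, (Icc p q).indicator g t)
      ((Icc p q).indicator g) := by
  have h1 := memH1_primitive_indicator hg p q
  have hzero : ∀ x ∈ Ioc 0 p, ∫ t in (0 : ℝ)..x, (Icc p q).indicator g t = 0 := fun x hx => by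
    rw [intervalIntegral.integral_of_le hx.1.le, integral_Ioc_eq_integral_Ioo]
    exact setIntegral_eq_zero_of_forall_eq_zero fun t ht =>
      indicator_of_notMem (fun h => (ht.2.trans_le hx.2).not_ge h.1) g
  refine ⟨⟨h1, ?_, ?_⟩, by simp⟩
  · exact ((h1.cont.pow 2).integrableOn_compact isCompact_Icc).mono_set Ioo_subset_Icc_self
  · have hl : IntegrableOn (fun x => (∫ t in (0 : ℝ)..x, (Icc p q).indicator g t) ^ 2 /
        sigW a b x) (Ioc 0 p) :=
      (integrableOn_zero (ε' := ℝ)).congr_fun (fun x hx => by simp [hzero x hx]) measurableSet_Ioc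
    have hr : IntegrableOn (fun x => (∫ t in (0 : ℝ)..x, (Icc p q).indicator g t) ^ 2 /
        sigW a b x) (Icc p 1) :=
      ((continuousOn_sq_div_sigW ha hapos hba h1.cont).mono
        fun x hx => ⟨hp.trans_le hx.1, hx.2⟩).integrableOn_compact isCompact_Icc
    refine (hl.union hr).mono_set fun x hx => ?_
    rcases le_total x p with h | h
    · exact Or.inl ⟨hx.1, h⟩
    · exact Or.inr ⟨h, hx.2.le⟩

theorem integrableOn_sq_div_sigW_of_hardy (ha : ContinuousOn a (Icc 0 1))
    (hapos : ∀ x ∈ Ioc (0 : ℝ) 1, 0 < a x)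
    (hba : IntegrableOn (fun x => b x / a x) (Ioo (0 : ℝ) 1)) {C : ℝ} (hC : 0 ≤ C)
    (hHP : ∀ v v' : ℝ → ℝ, MemH1sig0 a b v v' →
      ∫ x in Ioo (0 : ℝ) 1, v x ^ 2 / sigW a b x ≤ C * ∫ x in Ioo (0 : ℝ) 1, v' x ^ 2) :
    IntegrableOn (fun x => x ^ 2 / sigW a b x) (Ioo 0 1) := by
  have hcont := continuousOn_sq_div_sigW ha hapos hba (continuousOn_id (s := Icc (0 : ℝ) 1))
  simp only [id] at hcont
  have hd : ∀ n : ℕ, (0 : ℝ) < 1 / ((n : ℝ) + 1) := fun n => Nat.one_div_pos_of_nat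
  have hint : ∀ n : ℕ, IntegrableOn (fun x => x ^ 2 / sigW a b x) (Ioc (1 / ((n : ℝ) + 1)) 1) :=
    fun n => ((hcont.mono fun x hx => ⟨(hd n).trans_le hx.1, hx.2⟩).integrableOn_compact
      isCompact_Icc).mono_set Ioc_subset_Icc_self
  refine (integrableOn_Ioc_of_intervalIntegral_norm_bounded_left (I := 4 * C) hint
    tendsto_one_div_add_atTop_nhds_zero_nat (Eventually.of_forall fun n => ?_)).mono_set
    Ioo_subset_Ioc_self
  set d : ℝ := 1 / ((n : ℝ) + 1) with hdef
  have hd0 : 0 < d := hd n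
  have hmem := memH1sig0_primitive_indicator_of_pos (b := b) ha hapos hba
    (continuousOn_const (c := (1 : ℝ))) (half_pos hd0) 1
  set v : ℝ → ℝ := fun x => ∫ t in (0 : ℝ)..x, (Icc (d / 2) 1).indicator (fun _ => (1 : ℝ)) t
    with hv
  have hvx : ∀ x ∈ Ioo d 1, v x = x - d / 2 := fun x hx => by
    have hx0 : 0 < x := hd0.trans hx.1
    simp only [hv]
    rw [intervalIntegral.integral_of_le hx0.le, setIntegral_indicator measurableSet_Icc]
    have : Ioc 0 x ∩ Icc (d / 2) 1 = Icc (d / 2) x := by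
      ext t
      simp only [mem_inter_iff, mem_Ioc, mem_Icc]
      exact ⟨fun h => ⟨h.2.1, h.1.2⟩,
        fun h => ⟨⟨by linarith [h.1], h.2⟩, h.1, h.2.trans hx.2.le⟩⟩
    rw [this]
    simp only [integral_const, smul_eq_mul, mul_one, measureReal_restrict_apply_univ]
    rw [Real.volume_real_Icc_of_le (by linarith [hx.1])]
  have hbound := hHP v _ hmem
  have hle1 : ∫ x in Ioo (0 : ℝ) 1, (Icc (d / 2) 1).indicator (fun _ => (1 : ℝ)) x ^ 2 ≤ 1 := by
    calc _ ≤ ∫ x in Ioo (0 : ℝ) 1, (1 : ℝ) := by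
          refine integral_mono hmem.deriv_sq_int (integrable_const _) fun x => ?_
          by_cases h : x ∈ Icc (d / 2) 1 <;> simp only [h, indicator_of_mem, indicator_of_notMem,
            not_false_eq_true] <;> norm_num
      _ = 1 := by simp
  rw [integral_Ioc_eq_integral_Ioo]
  have hsub : Ioo d 1 ⊆ Ioo 0 1 := Ioo_subset_Ioo_left hd0.le
  calc ∫ x in Ioo d 1, ‖x ^ 2 / sigW a b x‖
      ≤ ∫ x in Ioo d 1, 4 * (v x ^ 2 / sigW a b x) := by
        refine setIntegral_mono_on ((hint n).mono_set Ioo_subset_Ioc_self).norm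
          ((hmem.l2sig.2.mono_set hsub).const_mul 4) measurableSet_Ioo fun x hx => ?_
        have hs := sigW_pos (b := b) hapos (Ioo_subset_Ioc_self (hsub hx))
        rw [Real.norm_of_nonneg (by positivity), hvx x hx, ← mul_div_assoc]
        gcongr
        nlinarith [hx.1]
    _ ≤ ∫ x in Ioo (0 : ℝ) 1, 4 * (v x ^ 2 / sigW a b x) := by
        refine setIntegral_mono_set (hmem.l2sig.2.const_mul 4) ?_ hsub.eventuallyLE
        filter_upwards [ae_restrict_mem measurableSet_Ioo] with x hx
        have hs := sigW_pos (b := b) hapos (Ioo_subset_Ioc_self hx)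
        simp only [Pi.zero_apply]
        positivity
    _ = 4 * ∫ x in Ioo (0 : ℝ) 1, v x ^ 2 / sigW a b x := integral_const_mul _ _
    _ ≤ 4 * C := by
        have := mul_le_mul_of_nonneg_left hle1 hC
        linarith

theorem memH1sig0_primitive_indicator (ha : ContinuousOn a (Icc 0 1))
    (hapos : ∀ x ∈ Ioc (0 : ℝ) 1, 0 < a x)
    (hba : IntegrableOn (fun x => b x / a x) (Ioo (0 : ℝ) 1))
    (hsq : IntegrableOn (fun x => x ^ 2 / sigW a b x) (Ioo 0 1))
    {g : ℝ → ℝ} (hg : ContinuousOn g (Icc 0 1)) (p q : ℝ) :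
    MemH1sig0 a b (fun x => ∫ t in (0 : ℝ)..x, (Icc p q).indicator g t)
      ((Icc p q).indicator g) := by
  have h1 := memH1_primitive_indicator hg p q
  obtain ⟨M, hM⟩ := isCompact_Icc.exists_bound_of_continuousOn hg
  refine ⟨⟨h1, ?_, ?_⟩, by simp⟩
  · exact ((h1.cont.pow 2).integrableOn_compact isCompact_Icc).mono_set Ioo_subset_Icc_self
  · refine Integrable.mono' (hsq.const_mul (M ^ 2))
      (((continuousOn_sq_div_sigW ha hapos hba h1.cont).mono
        Ioo_subset_Ioc_self).aestronglyMeasurable measurableSet_Ioo) ?_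
    filter_upwards [ae_restrict_mem measurableSet_Ioo] with x hx
    have hs := sigW_pos (b := b) hapos (Ioo_subset_Ioc_self hx)
    rw [Real.norm_of_nonneg (by positivity), ← mul_div_assoc, ← mul_pow]
    gcongr ?_ / _
    rw [← sq_abs]
    gcongr
    exact abs_primitive_indicator_le hM p q (Ioo_subset_Icc_self hx)

theorem MemH1sig0.integral_Ioo_deriv {u u' : ℝ → ℝ} (h : MemH1sig0 a b u u') {x : ℝ}
    (hx : x ∈ Icc (0 : ℝ) 1) : ∫ t in Ioo 0 x, u' t = u x := by
  rw [h.ftc x hx, h.zero, zero_add]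

end Weight

/-- Well-posedness of the auxiliary variational problem
`∫ η z' φ' + β z(1) φ(1) = λ φ(1)` on `H¹_{1/σ,0}(0,1)`, with the stated
estimates, extra regularity `z ∈ H²_{1/σ,0}`, `(η z')' = 0` a.e., and the
boundary condition `η(1) z'(1) + β z(1) = λ`. -/
theorem stmt10 (a b : ℝ → ℝ) (β C_HP lam : ℝ)
    (ha : ContinuousOn a (Set.Icc 0 1)) (hb : ContinuousOn b (Set.Icc 0 1))
    (ha0 : a 0 = 0) (hapos : ∀ x ∈ Set.Ioc (0:ℝ) 1, 0 < a x)
    (hba : IntegrableOn (fun x => b x / a x) (Set.Ioo (0:ℝ) 1))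
    (hH0 : HypH0 a) (hβ : 0 ≤ β) (hC_HP : 0 < C_HP)
    (hHP : ∀ v v' : ℝ → ℝ, MemH1sig0 a b v v' →
      ∫ x in Set.Ioo (0:ℝ) 1, (v x) ^ 2 / sigW a b x ≤
        C_HP * ∫ x in Set.Ioo (0:ℝ) 1, (v' x) ^ 2) :
    ∃ z z' : ℝ → ℝ, MemH1sig0 a b z z' ∧
      (∀ φ φ' : ℝ → ℝ, MemH1sig0 a b φ φ' →
        (∫ x in Set.Ioo (0:ℝ) 1, etaW a b x * z' x * φ' x) + β * z 1 * φ 1 =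
          lam * φ 1) ∧
      (∫ x in Set.Ioo (0:ℝ) 1, etaW a b x * (z' x) ^ 2) + β * (z 1) ^ 2 ≤
        lam ^ 2 / sInf (etaW a b '' Set.Icc 0 1) ∧
      (∫ x in Set.Ioo (0:ℝ) 1, (z x) ^ 2 / sigW a b x) ≤
        ((sSup (etaW a b '' Set.Icc 0 1) + C_HP) /
          (sInf (etaW a b '' Set.Icc 0 1)) ^ 2) * lam ^ 2 ∧
      (∃ w : ℝ → ℝ, MemH2sig0 a b z z' w ∧
        (∀ᵐ x ∂(volume.restrict (Set.Ioo (0:ℝ) 1)), w x = 0)) ∧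
      etaW a b 1 * z' 1 + β * z 1 = lam ∧
      (∀ z₂ z₂' : ℝ → ℝ, MemH1sig0 a b z₂ z₂' →
        (∀ φ φ' : ℝ → ℝ, MemH1sig0 a b φ φ' →
          (∫ x in Set.Ioo (0:ℝ) 1, etaW a b x * z₂' x * φ' x) + β * z₂ 1 * φ 1 =
            lam * φ 1) →
        Set.EqOn z₂ z (Set.Icc 0 1)) := by
  set η := etaW a b with hη
  have hηpos : ∀ x, 0 < η x := etaW_pos a b
  have hηc : ContinuousOn η (Icc 0 1) := continuousOn_etaW hba
  have hinvc : ContinuousOn (fun x => (η x)⁻¹) (Icc 0 1) := hηc.inv₀ fun x _ => (hηpos x).ne'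
  have hinvi : IntegrableOn (fun x => (η x)⁻¹) (Ioo 0 1) :=
    (hinvc.integrableOn_compact isCompact_Icc).mono_set Ioo_subset_Icc_self
  have hsq := integrableOn_sq_div_sigW_of_hardy ha hapos hba hC_HP.le hHP
  set m := sInf (η '' Icc 0 1) with hm
  have hm0 : 0 < m := by
    obtain ⟨x, -, hx⟩ := (isCompact_Icc.image_of_continuousOn hηc).sInf_mem
      ((nonempty_Icc.2 zero_le_one).image η)
    rw [hm, ← hx]
    exact hηpos x
  have hmle : ∀ x ∈ Icc (0 : ℝ) 1, m ≤ η x := fun x hx =>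
    csInf_le ⟨0, by rintro _ ⟨y, -, rfl⟩; exact (hηpos y).le⟩ (mem_image_of_mem η hx)
  have hsup : 0 ≤ sSup (η '' Icc 0 1) :=
    Real.sSup_nonneg (by rintro _ ⟨y, -, rfl⟩; exact (hηpos y).le)
  set S := ∫ t in Ioo (0 : ℝ) 1, (η t)⁻¹ with hS
  have hS0 : 0 ≤ S := integral_nonneg fun x => (inv_pos.2 (hηpos x)).le
  have hSm : S ≤ 1 / m := by
    calc S ≤ ∫ t in Ioo (0 : ℝ) 1, 1 / m := by
          refine setIntegral_mono_on hinvi (integrable_const _) measurableSet_Ioo fun x hx => ?_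
          rw [one_div]
          exact inv_anti₀ hm0 (hmle x (Ioo_subset_Icc_self hx))
      _ = 1 / m := by simp
  have hden : 1 ≤ 1 + β * S := by nlinarith [mul_nonneg hβ hS0]
  have hden0 : 0 < 1 + β * S := by linarith
  set c := lam / (1 + β * S) with hc
  have hceq : c * (1 + β * S) = lam := div_mul_cancel₀ _ hden0.ne'
  have hc2 : c ^ 2 ≤ lam ^ 2 := by
    rw [← hceq, mul_pow]
    exact le_mul_of_one_le_right (sq_nonneg c) (one_le_pow₀ hden)
  set g : ℝ → ℝ := fun x => c * (η x)⁻¹ with hg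
  have hgc : ContinuousOn g (Icc 0 1) := continuousOn_const.mul hinvc
  have hz := memH1sig0_primitive_indicator ha hapos hba hsq hgc 0 1
  set z' := (Icc (0 : ℝ) 1).indicator g with hz'
  set z : ℝ → ℝ := fun x => ∫ t in (0 : ℝ)..x, z' t with hzdef
  have hz'x : ∀ x ∈ Icc (0 : ℝ) 1, z' x = c * (η x)⁻¹ := fun x hx => indicator_of_mem hx g
  have hflux : ∀ x ∈ Icc (0 : ℝ) 1, η x * z' x = c := fun x hx => by
    rw [hz'x x hx, mul_left_comm, mul_inv_cancel₀ (hηpos x).ne', mul_one]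
  have hzx : ∀ x ∈ Icc (0 : ℝ) 1, z x = c * ∫ t in Ioo 0 x, (η t)⁻¹ := fun x hx => by
    rw [← hz.integral_Ioo_deriv hx, ← integral_const_mul]
    exact setIntegral_congr_fun measurableSet_Ioo fun t ht =>
      hz'x t ⟨ht.1.le, ht.2.le.trans hx.2⟩
  have h1mem : (1 : ℝ) ∈ Icc (0 : ℝ) 1 := by simp
  have hz1 : z 1 = c * S := hzx 1 h1mem
  refine ⟨z, z', hz, ?_, ?_, ?_, ⟨fun _ => 0, ⟨⟨hz.toMemH1sig, ?_, ?_, ?_⟩, hz.zero⟩, ?_⟩, ?_, ?_⟩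
  · intro φ φ' hφ
    have : ∫ x in Ioo (0 : ℝ) 1, η x * z' x * φ' x = c * φ 1 := by
      rw [← hφ.integral_Ioo_deriv h1mem, ← integral_const_mul]
      exact setIntegral_congr_fun measurableSet_Ioo fun t ht => by
        simp only [hflux t (Ioo_subset_Icc_self ht)]
    rw [this, hz1, ← hceq]
    ring
  · have : ∫ x in Ioo (0 : ℝ) 1, η x * z' x ^ 2 = c * z 1 := by
      rw [← hz.integral_Ioo_deriv h1mem, ← integral_const_mul]
      exact setIntegral_congr_fun measurableSet_Ioo fun t ht => by
        simp only [sq, ← mul_assoc, hflux t (Ioo_subset_Icc_self ht)]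
    rw [this, hz1, div_eq_mul_one_div]
    calc c * (c * S) + β * (c * S) ^ 2 = c ^ 2 * (1 + β * S) * S := by ring
      _ ≤ lam ^ 2 * S := by
          gcongr
          rw [← hceq, mul_pow]
          gcongr
          nlinarith
      _ ≤ lam ^ 2 * (1 / m) := by gcongr
  · have hle : ∫ x in Ioo (0 : ℝ) 1, z' x ^ 2 ≤ lam ^ 2 / m ^ 2 := by
      calc ∫ x in Ioo (0 : ℝ) 1, z' x ^ 2 ≤ ∫ x in Ioo (0 : ℝ) 1, lam ^ 2 / m ^ 2 := by
            refine setIntegral_mono_on hz.deriv_sq_int (integrable_const _) measurableSet_Ioo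
              fun x hx => ?_
            have hx' := Ioo_subset_Icc_self hx
            rw [hz'x x hx', ← div_eq_mul_inv, div_pow]
            gcongr
            exact hmle x hx'
        _ = lam ^ 2 / m ^ 2 := by simp
    calc _ ≤ C_HP * ∫ x in Ioo (0 : ℝ) 1, z' x ^ 2 := hHP z z' hz
      _ ≤ C_HP * (lam ^ 2 / m ^ 2) := by gcongr
      _ ≤ (sSup (η '' Icc 0 1) + C_HP) * (lam ^ 2 / m ^ 2) := by
          gcongr
          linarith
      _ = _ := by ring
  · exact fun c _ => integrableOn_zero
  · intro d hd x hx
    have hd' : d ∈ Icc (0 : ℝ) 1 := Ioc_subset_Icc_self hd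
    rw [← hη, hflux x ⟨hd'.1.trans hx.1, hx.2⟩, hflux d hd']
    simp
  · constructor <;> simp
  · simp
  · rw [hflux 1 h1mem, hz1, ← hceq]
    ring
  · intro u u' hu hvar
    have hut : ∀ t ∈ Icc (0 : ℝ) 1, u t = (lam - β * u 1) * ∫ s in Ioo 0 t, (η s)⁻¹ := by
      intro t ht
      have h := hvar _ _ (memH1sig0_primitive_indicator ha hapos hba hsq hinvc 0 t)
      have hint : ∫ x in Ioo (0 : ℝ) 1,
          η x * u' x * (Icc 0 t).indicator (fun x => (η x)⁻¹) x = u t := by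
        rw [← hu.integral_Ioo_deriv ht, ← primitive_indicator_eq u' ht,
          intervalIntegral.integral_of_le zero_le_one, integral_Ioc_eq_integral_Ioo]
        refine setIntegral_congr_fun measurableSet_Ioo fun x _ => ?_
        have := (hηpos x).ne'
        by_cases hx : x ∈ Icc 0 t
        · simp only [hx, indicator_of_mem]
          field_simp
        · simp only [hx, indicator_of_notMem, not_false_eq_true, mul_zero]
      rw [hint, primitive_indicator_eq _ ht] at h
      linarith
    have hu1 : u 1 = c * S := by
      have h := hut 1 h1mem
      rw [hc, div_mul_eq_mul_div, eq_div_iff hden0.ne']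
      linarith
    intro t ht
    rw [hut t ht, hzx t ht, hu1]
    congr 1
    linarith
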